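/- arXiv:2402.12502 — 4 statements merged into one kernel-verified Lean document; each statement's English description precedes it below -/
import Mathlib

section
/- Let d ≥ 1 be an integer and 1 < λ ≤ 2, and define V_λ : ℝ^d → ℝ by V_λ(x) = (1 + ‖x‖²)^{λ/2}. Then V_λ is twice differentiable; its gradient is ∇V_λ(x) = λ(1+‖x‖²)^{(λ−2)/2} x and satisfies ‖∇V_λ(x)‖ ≤ λ‖x‖^{λ−1} for all x; and the second derivative, viewed as a bilinear form, satisfies |D²V_λ(x)(u,v)| ≤ λ(3−λ)√d · ‖u‖·‖v‖ for all x, u, v ∈ ℝ^d. -/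
section

variable {E : Type*} [NormedAddCommGroup E] [InnerProductSpace ℝ E]

lemma hasFDerivAt_one_add_norm_sq_rpow (p : ℝ) (x : E) :
    HasFDerivAt (fun y : E => (1 + ‖y‖ ^ 2) ^ p)
      ((2 * p * (1 + ‖x‖ ^ 2) ^ (p - 1)) • innerSL ℝ x) x := by
  have h := ((hasStrictFDerivAt_norm_sq x).hasFDerivAt.const_add (1 : ℝ)).rpow_const (p := p)
    (Or.inl (by positivity))
  convert h using 1
  rw [two_smul, ← two_smul ℝ, smul_smul]
  ring_nf

lemma fderiv_one_add_norm_sq_rpow (p : ℝ) :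
    fderiv ℝ (fun y : E => (1 + ‖y‖ ^ 2) ^ p) =
      fun x => (2 * p * (1 + ‖x‖ ^ 2) ^ (p - 1)) • innerSL ℝ x :=
  funext fun x => (hasFDerivAt_one_add_norm_sq_rpow p x).fderiv

lemma fderiv_fderiv_one_add_norm_sq_rpow_apply (p : ℝ) (x u v : E) :
    fderiv ℝ (fderiv ℝ (fun y : E => (1 + ‖y‖ ^ 2) ^ p)) x u v =
      2 * p * (1 + ‖x‖ ^ 2) ^ (p - 1) * inner ℝ u v +
        2 * p * (2 * (p - 1) * (1 + ‖x‖ ^ 2) ^ (p - 2)) * inner ℝ x u * inner ℝ x v := by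
  have h : HasFDerivAt (fun y : E => (2 * p * (1 + ‖y‖ ^ 2) ^ (p - 1)) • innerSL ℝ y) _ x :=
    ((hasFDerivAt_one_add_norm_sq_rpow (p - 1) x).const_mul (2 * p)).smul
      (innerSL ℝ (E := E)).hasFDerivAt
  have huv : innerSL ℝ u v = inner ℝ u v := rfl
  rw [fderiv_one_add_norm_sq_rpow, h.fderiv]
  simp [huv]
  left
  ring_nf

lemma gradient_one_add_norm_sq_rpow [CompleteSpace E] (p : ℝ) (x : E) :
    gradient (fun y : E => (1 + ‖y‖ ^ 2) ^ p) x =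
      (2 * p * (1 + ‖x‖ ^ 2) ^ (p - 1)) • x := by
  apply HasGradientAt.gradient
  rw [hasGradientAt_iff_hasFDerivAt]
  refine (hasFDerivAt_one_add_norm_sq_rpow p x).congr_fderiv ?_
  ext v
  simp

lemma abs_fderiv_fderiv_one_add_norm_sq_rpow_le {p : ℝ} (hp0 : 0 ≤ p) (hp1 : p ≤ 1)
    (x u v : E) :
    |fderiv ℝ (fderiv ℝ (fun y : E => (1 + ‖y‖ ^ 2) ^ p)) x u v| ≤
      2 * p * (3 - 2 * p) * (‖u‖ * ‖v‖) := by
  rw [fderiv_fderiv_one_add_norm_sq_rpow_apply]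
  have hs : 1 ≤ 1 + ‖x‖ ^ 2 := by nlinarith [sq_nonneg ‖x‖]
  have hA : (1 + ‖x‖ ^ 2) ^ (p - 1) ≤ 1 :=
    Real.rpow_le_one_of_one_le_of_nonpos hs (by linarith)
  have hA0 : 0 ≤ (1 + ‖x‖ ^ 2) ^ (p - 1) := by positivity
  have hB0 : 0 ≤ (1 + ‖x‖ ^ 2) ^ (p - 2) := by positivity
  have hB : (1 + ‖x‖ ^ 2) ^ (p - 2) * ‖x‖ ^ 2 ≤ 1 := by
    have : (1 + ‖x‖ ^ 2) ^ (p - 1) = (1 + ‖x‖ ^ 2) ^ (p - 2) * (1 + ‖x‖ ^ 2) := by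
      rw [← Real.rpow_add_one (by positivity)]
      ring_nf
    nlinarith
  have h₁ : |(1 + ‖x‖ ^ 2) ^ (p - 1) * inner ℝ u v| ≤ ‖u‖ * ‖v‖ := by
    rw [abs_mul, abs_of_nonneg hA0]
    calc _ ≤ 1 * (‖u‖ * ‖v‖) := by gcongr; exact abs_real_inner_le_norm u v
      _ = _ := one_mul _
  have h₂ : |(1 + ‖x‖ ^ 2) ^ (p - 2) * (inner ℝ x u * inner ℝ x v)| ≤ ‖u‖ * ‖v‖ := by
    rw [abs_mul, abs_mul, abs_of_nonneg hB0]
    calc _ ≤ (1 + ‖x‖ ^ 2) ^ (p - 2) * ((‖x‖ * ‖u‖) * (‖x‖ * ‖v‖)) := by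
          gcongr <;> exact abs_real_inner_le_norm _ _
      _ = (1 + ‖x‖ ^ 2) ^ (p - 2) * ‖x‖ ^ 2 * (‖u‖ * ‖v‖) := by ring
      _ ≤ 1 * (‖u‖ * ‖v‖) := by gcongr
      _ = _ := one_mul _
  calc _ = |2 * p * ((1 + ‖x‖ ^ 2) ^ (p - 1) * inner ℝ u v) -
          2 * p * (2 * (1 - p)) * ((1 + ‖x‖ ^ 2) ^ (p - 2) * (inner ℝ x u * inner ℝ x v))| := by
        ring_nf
    _ ≤ 2 * p * |(1 + ‖x‖ ^ 2) ^ (p - 1) * inner ℝ u v| + 2 * p * (2 * (1 - p)) *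
          |(1 + ‖x‖ ^ 2) ^ (p - 2) * (inner ℝ x u * inner ℝ x v)| := by
        refine (abs_sub _ _).trans_eq ?_
        have hc : 0 ≤ 2 * p * (2 * (1 - p)) := by
          have : 0 ≤ 1 - p := by linarith
          positivity
        rw [abs_mul, abs_mul (2 * p * (2 * (1 - p))), abs_of_nonneg hc,
          abs_of_nonneg (by positivity : 0 ≤ 2 * p)]
    _ ≤ 2 * p * (‖u‖ * ‖v‖) + 2 * p * (2 * (1 - p)) * (‖u‖ * ‖v‖) := by
        have : 0 ≤ 1 - p := by linarith
        gcongr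
    _ = _ := by ring

end

lemma one_add_sq_rpow_mul_le {a r : ℝ} (ha : a ≤ 0) (hr : 0 ≤ r) :
    (1 + r ^ 2) ^ (a / 2) * r ≤ r ^ (a + 1) := by
  obtain rfl | hr := hr.eq_or_lt
  · simpa using Real.rpow_nonneg le_rfl (a + 1)
  · rw [Real.rpow_add_one hr.ne']
    gcongr
    calc (1 + r ^ 2) ^ (a / 2) ≤ (r ^ 2) ^ (a / 2) :=
          Real.rpow_le_rpow_of_nonpos (by positivity) (by linarith) (by linarith)
      _ = r ^ a := by
          rw [← Real.rpow_natCast, ← Real.rpow_mul hr.le]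
          congr 1
          push_cast
          ring

theorem lyapunov_function_derivative_bounds
    (d : ℕ) (hd : 1 ≤ d) (lam : ℝ) (h1 : 1 < lam) (h2 : lam ≤ 2) :
    ContDiff ℝ 2 (fun x : EuclideanSpace ℝ (Fin d) => (1 + ‖x‖ ^ 2) ^ (lam / 2)) ∧
    (∀ x : EuclideanSpace ℝ (Fin d),
      gradient (fun y : EuclideanSpace ℝ (Fin d) => (1 + ‖y‖ ^ 2) ^ (lam / 2)) x
        = (lam * (1 + ‖x‖ ^ 2) ^ ((lam - 2) / 2)) • x) ∧
    (∀ x : EuclideanSpace ℝ (Fin d),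
      ‖gradient (fun y : EuclideanSpace ℝ (Fin d) => (1 + ‖y‖ ^ 2) ^ (lam / 2)) x‖
        ≤ lam * ‖x‖ ^ (lam - 1)) ∧
    (∀ x u v : EuclideanSpace ℝ (Fin d),
      |fderiv ℝ (fderiv ℝ (fun y : EuclideanSpace ℝ (Fin d) => (1 + ‖y‖ ^ 2) ^ (lam / 2))) x u v|
        ≤ lam * (3 - lam) * Real.sqrt d * ‖u‖ * ‖v‖) := by
  have hgrad (x : EuclideanSpace ℝ (Fin d)) :
      gradient (fun y : EuclideanSpace ℝ (Fin d) => (1 + ‖y‖ ^ 2) ^ (lam / 2)) x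
        = (lam * (1 + ‖x‖ ^ 2) ^ ((lam - 2) / 2)) • x := by
    rw [gradient_one_add_norm_sq_rpow, mul_div_cancel₀ lam two_ne_zero, sub_div,
      div_self (two_ne_zero' ℝ)]
  refine ⟨?_, hgrad, fun x => ?_, fun x u v => ?_⟩
  · exact (contDiff_const.add (contDiff_norm_sq ℝ)).rpow_const_of_ne fun x => by positivity
  · rw [hgrad, norm_smul, Real.norm_of_nonneg (by positivity), mul_assoc]
    gcongr
    rw [show lam - 1 = lam - 2 + 1 by ring]
    exact one_add_sq_rpow_mul_le (sub_nonpos.mpr h2) (norm_nonneg x)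
  · have hd' : 1 ≤ Real.sqrt d := Real.one_le_sqrt.mpr (by exact_mod_cast hd)
    have h3 : 0 ≤ 3 - lam := by linarith
    calc _ ≤ 2 * (lam / 2) * (3 - 2 * (lam / 2)) * (‖u‖ * ‖v‖) :=
          abs_fderiv_fderiv_one_add_norm_sq_rpow_le (by linarith) (by linarith) x u v
      _ = lam * (3 - lam) * 1 * ‖u‖ * ‖v‖ := by ring
      _ ≤ _ := by gcongr
end

section
/- Let d ≥ 1 be an integer, θ₄ > 0, K ≥ 0, 1 < λ < 2, and let b : ℝ^d → ℝ^d satisfy ⟨b(x) − b(0), x⟩ ≤ −θ₄‖x‖² + K for all x ∈ ℝ^d. Then for every x ∈ ℝ^d, λ(1+‖x‖²)^{(λ−2)/2}⟨b(x), x⟩ ≤ −θ₄(1+‖x‖²)^{λ/2} + λ(θ₄ + K) + ‖b(0)‖^λ·θ₄^{1−λ}. -/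
open scoped RealInnerProductSpace

/-- A weighted form of Young's inequality, obtained by homogenizing Bernoulli's inequality. -/
theorem mul_rpow_sub_one_le_of_one_le {p t u B : ℝ} (hp : 1 ≤ p) (ht : 0 < t) (hu : 0 < u)
    (hB : 0 ≤ B) :
    p * B * u ^ (p - 1) ≤ (p - 1) * t * u ^ p + B ^ p * t ^ (1 - p) := by
  have htu : 0 < t * u := mul_pos ht hu
  have hq : 0 ≤ B / (t * u) := div_nonneg hB htu.le
  have bernoulli := one_add_mul_self_le_rpow_one_add (s := B / (t * u) - 1) (by linarith) hp
  rw [add_sub_cancel, Real.div_rpow hB htu.le, Real.mul_rpow ht.le hu.le] at bernoulli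
  have hup : 0 < u ^ p := Real.rpow_pos_of_pos hu p
  have htp : 0 < t ^ p := Real.rpow_pos_of_pos ht p
  have key := mul_le_mul_of_nonneg_left bernoulli (mul_pos ht hup).le
  have e1 : t * u ^ p * (1 + p * (B / (t * u) - 1))
      = p * B * (u ^ p / u) - (p - 1) * t * u ^ p := by
    field_simp
    ring
  have e2 : t * u ^ p * (B ^ p / (t ^ p * u ^ p)) = B ^ p * (t / t ^ p) := by
    field_simp
  rw [Real.rpow_sub_one hu.ne', Real.rpow_sub ht, Real.rpow_one]
  linarith

theorem lyapunov_drift_estimate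
    (d : ℕ) (hd : 1 ≤ d) (θ₄ K lam : ℝ) (hθ₄ : 0 < θ₄) (hK : 0 ≤ K)
    (h1 : 1 < lam) (h2 : lam < 2)
    (b : EuclideanSpace ℝ (Fin d) → EuclideanSpace ℝ (Fin d))
    (hb : ∀ x, ⟪b x - b 0, x⟫ ≤ -θ₄ * ‖x‖ ^ 2 + K) :
    ∀ x : EuclideanSpace ℝ (Fin d),
      lam * (1 + ‖x‖ ^ 2) ^ ((lam - 2) / 2) * ⟪b x, x⟫
        ≤ -θ₄ * (1 + ‖x‖ ^ 2) ^ (lam / 2) + lam * (θ₄ + K) + ‖b 0‖ ^ lam * θ₄ ^ (1 - lam) := by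
  intro x
  have hs : 1 ≤ 1 + ‖x‖ ^ 2 := by nlinarith [sq_nonneg ‖x‖]
  obtain ⟨u, hu, hxu⟩ : ∃ u : ℝ, 1 ≤ u ∧ 1 + ‖x‖ ^ 2 = u ^ 2 :=
    ⟨√(1 + ‖x‖ ^ 2), Real.one_le_sqrt.2 hs, (Real.sq_sqrt (by linarith)).symm⟩
  have hu0 : 0 < u := by linarith
  have hpow (a : ℝ) : (u ^ 2) ^ (a / 2) = u ^ a := by
    rw [← Real.rpow_natCast_mul hu0.le]
    congr 1
    push_cast
    ring
  rw [hxu, hpow, hpow]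
  have hr : ‖x‖ ≤ u := by nlinarith [norm_nonneg x]
  have hinner : ⟪b x, x⟫ ≤ -θ₄ * u ^ 2 + (θ₄ + K) + ‖b 0‖ * u := by
    have h := hb x
    rw [inner_sub_left] at h
    have hcs := real_inner_le_norm (b 0) x
    have hmul := mul_le_mul_of_nonneg_left hr (norm_nonneg (b 0))
    have hx : ‖x‖ ^ 2 = u ^ 2 - 1 := by linarith
    rw [hx] at h
    linarith
  have hw : 0 < u ^ (lam - 2) := Real.rpow_pos_of_pos hu0 _
  have hw1 : u ^ (lam - 2) ≤ 1 := Real.rpow_le_one_of_one_le_of_nonpos hu (by linarith)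
  have e1 : u ^ (lam - 1) = u ^ (lam - 2) * u := by
    rw [← Real.rpow_add_one hu0.ne']
    ring_nf
  have e2 : u ^ lam = u ^ (lam - 2) * u ^ 2 := by
    rw [← Real.rpow_add_natCast hu0.ne']
    push_cast
    ring_nf
  have young := mul_rpow_sub_one_le_of_one_le h1.le hθ₄ hu0 (norm_nonneg (b 0))
  rw [e1, e2] at young
  rw [e2]
  have hdrift := mul_le_mul_of_nonneg_left hinner (mul_pos (by linarith : 0 < lam) hw).le
  have hconst := mul_le_mul_of_nonneg_left hw1
    (mul_nonneg (by linarith : 0 ≤ lam) (by linarith : 0 ≤ θ₄ + K))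
  linarith
end

section
/- Let 1 < α < 2. Then the function η ↦ (η/(1 − (1−η)^α))^{1/α} − (1/α)^{1/α} is O(η) as η → 0 from the right (with respect to the filter of right-neighborhoods of 0), where all powers are real powers of positive bases. -/
open Asymptotics Filter

/-- The difference quotient of a function analytic at a point is differentiable at that point. -/
theorem AnalyticAt.differentiableAt_dslope {𝕜 E : Type*} [NontriviallyNormedField 𝕜]
    [NormedAddCommGroup E] [NormedSpace 𝕜 E] {f : 𝕜 → E} {a : 𝕜} (hf : AnalyticAt 𝕜 f a) :
    DifferentiableAt 𝕜 (dslope f a) a := by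
  obtain ⟨p, hp⟩ := hf
  exact hp.has_fpower_series_dslope_fslope.differentiableAt

theorem ou_invariant_scale_root_expansion
    (α : ℝ) (hα : 1 < α) (hα2 : α < 2) :
    (fun η : ℝ => (η / (1 - (1 - η) ^ α)) ^ (1 / α) - ((1 : ℝ) / α) ^ (1 / α))
      =O[nhdsWithin 0 (Set.Ioi 0)] fun η : ℝ => η := by
  have hα0 : α ≠ 0 := by positivity
  set f : ℝ → ℝ := fun x => 1 - (1 - x) ^ α with hf
  have hfa : AnalyticAt ℝ f 0 :=
    (contDiffAt_const.sub
      ((contDiffAt_const.sub contDiffAt_id).rpow_const_of_ne (by simp))).analyticAt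
  have hd : HasDerivAt f α 0 := by
    have h := ((((hasDerivAt_id (0 : ℝ)).const_sub 1).rpow_const (p := α)
      (Or.inl (by simp))).const_sub 1)
    simpa using h
  have h0 : dslope f 0 0 = α := by rw [dslope_same, hd.deriv]
  have hg : DifferentiableAt ℝ (fun x => (dslope f 0 x)⁻¹ ^ (1 / α)) 0 :=
    (hfa.differentiableAt_dslope.fun_inv (by rwa [h0])).rpow_const
      (Or.inl (inv_ne_zero (by rwa [h0])))
  refine (hg.isBigO_sub.mono nhdsWithin_le_nhds).congr' ?_ (by simp [EventuallyEq.refl])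
  filter_upwards [self_mem_nhdsWithin] with η hη
  have hη0 : η ≠ 0 := ne_of_gt hη
  rw [h0, dslope_of_ne f hη0, slope_def_field]
  simp [hf]
end

section
/- Let d ≥ 1 be an integer, 1 < α < 2, p_α > 0, and let h : ℝ^d → ℝ be twice continuously differentiable with M₁ := sup_x ‖∇h(x)‖ < ∞ and M₂ := sup_x ‖∇²h(x)‖_op < ∞. Define the fractional Laplacian Δ^{α/2}h(x) := Σ_{i=1}^d p_α ∫_ℝ (h(x + z eᵢ) − h(x) − ∂ᵢh(x)·z·1_{{|z|≤1}}(z))·|z|^{−1−α} dz, where each integral is a Lebesgue integral over ℝ. Then for all x, y ∈ ℝ^d, |Δ^{α/2}h(x) − Δ^{α/2}h(y)| ≤ (4 d p_α M₂ / ((2−α)(α−1)))·‖x − y‖^{2−α}. -/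
open MeasureTheory

/-- The fractional Laplacian `Δ^{α/2}` (with constant `pα`) of a function
`h : ℝ^d → ℝ`, defined coordinatewise through one-dimensional Lebesgue integrals. -/
noncomputable def fracLap (d : ℕ) (α pα : ℝ)
    (h : EuclideanSpace ℝ (Fin d) → ℝ) (x : EuclideanSpace ℝ (Fin d)) : ℝ :=
  ∑ i : Fin d, pα * ∫ z : ℝ,
    (h (x + z • EuclideanSpace.single i 1) - h x
      - fderiv ℝ h x (EuclideanSpace.single i 1) * z * (if |z| ≤ 1 then 1 else 0))
      * |z| ^ (-1 - α)

open Set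

section Kernel

variable {α r : ℝ}

lemma integrableOn_piecewise_rpow (hα : 1 < α) (hα2 : α < 2) (hr : 0 < r) (a b : ℝ) :
    IntegrableOn (fun t : ℝ => if t ≤ r then a * t ^ (1 - α) else b * t ^ (-α)) (Ioi 0) := by
  rw [← Ioc_union_Ioi_eq_Ioi hr.le]
  refine IntegrableOn.union ?_ ?_
  · have h1 : IntegrableOn (fun t : ℝ => a * t ^ (1 - α)) (Ioc 0 r) := by
      rw [← intervalIntegrable_iff_integrableOn_Ioc_of_le hr.le]
      exact (intervalIntegral.intervalIntegrable_rpow' (by linarith)).const_mul a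
    exact h1.congr_fun (fun t ht => by simp [ht.2]) measurableSet_Ioc
  · have h1 : IntegrableOn (fun t : ℝ => b * t ^ (-α)) (Ioi r) :=
      (integrableOn_Ioi_rpow_of_lt (by linarith) hr).const_mul b
    exact h1.congr_fun (fun t ht => by simp [not_le.2 (mem_Ioi.1 ht)]) measurableSet_Ioi

lemma integral_Ioi_piecewise_rpow (hα : 1 < α) (hα2 : α < 2) (hr : 0 < r) (a b : ℝ) :
    ∫ t in Ioi (0 : ℝ), (if t ≤ r then a * t ^ (1 - α) else b * t ^ (-α))
      = a * (r ^ (2 - α) / (2 - α)) + b * (r ^ (1 - α) / (α - 1)) := by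
  have hint := integrableOn_piecewise_rpow hα hα2 hr a b
  rw [← Ioc_union_Ioi_eq_Ioi hr.le] at hint ⊢
  rw [setIntegral_union (Ioc_disjoint_Ioi le_rfl) measurableSet_Ioi hint.left_of_union
    hint.right_of_union]
  congr 1
  · rw [setIntegral_congr_fun (g := fun t : ℝ => a * t ^ (1 - α)) measurableSet_Ioc
      (fun t ht => by simp [ht.2]), integral_const_mul,
      ← intervalIntegral.integral_of_le hr.le, integral_rpow (Or.inl (by linarith)),
      Real.zero_rpow (by linarith)]
    ring_nf
  · rw [setIntegral_congr_fun (g := fun t : ℝ => b * t ^ (-α)) measurableSet_Ioi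
      (fun t ht => by simp [not_le.2 (mem_Ioi.1 ht)]), integral_const_mul,
      integral_Ioi_rpow_of_lt (by linarith) hr]
    rw [← neg_div_neg_eq, neg_neg]
    ring_nf

lemma integrable_comp_abs {f : ℝ → ℝ} (hf : IntegrableOn f (Ioi 0)) :
    Integrable (fun z : ℝ => f |z|) := by
  have hpos : IntegrableOn (fun z : ℝ => f |z|) (Ioi 0) :=
    hf.congr_fun (fun z hz => by simp [abs_of_pos (mem_Ioi.1 hz)]) measurableSet_Ioi
  have hneg : IntegrableOn (fun z : ℝ => f |z|) (Iic 0) := by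
    have hm : MeasurableEmbedding fun z : ℝ => -z := (Homeomorph.neg ℝ).measurableEmbedding
    rw [← Measure.map_neg_eq_self (volume : Measure ℝ), hm.integrableOn_map_iff]
    simpa [Function.comp_def, integrableOn_Ici_iff_integrableOn_Ioi] using hpos
  rw [← integrableOn_univ, ← Iic_union_Ioi (a := (0 : ℝ))]
  exact hneg.union hpos

lemma integrable_piecewise_rpow_abs (hα : 1 < α) (hα2 : α < 2) (hr : 0 < r) (a b : ℝ) :
    Integrable (fun z : ℝ => if |z| ≤ r then a * |z| ^ (1 - α) else b * |z| ^ (-α)) :=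
  integrable_comp_abs
    (f := fun t : ℝ => if t ≤ r then a * t ^ (1 - α) else b * t ^ (-α))
    (integrableOn_piecewise_rpow hα hα2 hr a b)

lemma integral_piecewise_rpow_abs (hα : 1 < α) (hα2 : α < 2) (hr : 0 < r) (a b : ℝ) :
    ∫ z : ℝ, (if |z| ≤ r then a * |z| ^ (1 - α) else b * |z| ^ (-α))
      = 2 * (a * (r ^ (2 - α) / (2 - α)) + b * (r ^ (1 - α) / (α - 1))) := by
  rw [integral_comp_abs (f := fun t : ℝ => if t ≤ r then a * t ^ (1 - α) else b * t ^ (-α)),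
    integral_Ioi_piecewise_rpow hα hα2 hr]

lemma sq_mul_abs_rpow (hα : 1 < α) (z : ℝ) : z ^ 2 * |z| ^ (-1 - α) = |z| ^ (1 - α) := by
  rcases eq_or_ne z 0 with rfl | hz
  · simp [Real.zero_rpow (by linarith : (1 : ℝ) - α ≠ 0)]
  · rw [← sq_abs, ← Real.rpow_natCast, ← Real.rpow_add (abs_pos.2 hz)]
    congr 1; push_cast; ring

lemma abs_mul_abs_rpow (hα : 1 < α) (z : ℝ) : |z| * |z| ^ (-1 - α) = |z| ^ (-α) := by
  rcases eq_or_ne z 0 with rfl | hz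
  · simp [Real.zero_rpow (by linarith : -α ≠ 0)]
  · nth_rw 1 [← Real.rpow_one |z|]
    rw [← Real.rpow_add (abs_pos.2 hz)]
    congr 1; ring

lemma abs_mul_rpow_le_piecewise (hα : 1 < α) {z u a b : ℝ} (h₁ : |z| ≤ r → |u| ≤ a * z ^ 2)
    (h₂ : r < |z| → |u| ≤ b * |z|) :
    |u * |z| ^ (-1 - α)| ≤ if |z| ≤ r then a * |z| ^ (1 - α) else b * |z| ^ (-α) := by
  have hk : 0 ≤ |z| ^ (-1 - α) := by positivity
  rw [abs_mul, abs_of_nonneg hk]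
  split_ifs with hz
  · rw [← sq_mul_abs_rpow hα, ← mul_assoc]
    exact mul_le_mul_of_nonneg_right (h₁ hz) hk
  · rw [← abs_mul_abs_rpow hα, ← mul_assoc]
    exact mul_le_mul_of_nonneg_right (h₂ (not_le.1 hz)) hk

end Kernel

section MeanValue

variable {E : Type*} [NormedAddCommGroup E] [NormedSpace ℝ E] {h : E → ℝ} {M : ℝ}

lemma norm_fderiv_sub_le_of_norm_fderiv_fderiv_le (hsm : ContDiff ℝ 2 h)
    (hM : ∀ x, ‖fderiv ℝ (fderiv ℝ h) x‖ ≤ M) (x y : E) :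
    ‖fderiv ℝ h x - fderiv ℝ h y‖ ≤ M * ‖x - y‖ := by
  have hd : Differentiable ℝ (fderiv ℝ h) :=
    (hsm.fderiv_right (m := 1) (by norm_num)).differentiable (by norm_num)
  exact convex_univ.norm_image_sub_le_of_norm_fderiv_le (fun u _ => hd u) (fun u _ => hM u)
    (mem_univ y) (mem_univ x)

lemma abs_second_difference_le (hsm : ContDiff ℝ 2 h)
    (hM : ∀ x, ‖fderiv ℝ (fderiv ℝ h) x‖ ≤ M) (x y v : E) :
    |(h (x + v) - h x) - (h (y + v) - h y)| ≤ M * ‖v‖ * ‖x - y‖ := by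
  have hd : Differentiable ℝ h := hsm.differentiable (by norm_num)
  have hD (u : E) : HasFDerivWithinAt (fun u => h (u + v) - h u)
      (fderiv ℝ h (u + v) - fderiv ℝ h u) univ u :=
    (((hasFDerivAt_comp_add_right v).2 (hd (u + v)).hasFDerivAt).sub (hd u).hasFDerivAt).hasFDerivWithinAt
  refine convex_univ.norm_image_sub_le_of_norm_hasFDerivWithin_le (fun u _ => hD u)
    (fun u _ => ?_) (mem_univ y) (mem_univ x)
  simpa using norm_fderiv_sub_le_of_norm_fderiv_fderiv_le hsm hM (u + v) u

lemma abs_taylor_remainder_le (hsm : ContDiff ℝ 2 h)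
    (hM : ∀ x, ‖fderiv ℝ (fderiv ℝ h) x‖ ≤ M) (x v : E) :
    |h (x + v) - h x - fderiv ℝ h x v| ≤ M * ‖v‖ ^ 2 := by
  have hd : Differentiable ℝ h := hsm.differentiable (by norm_num)
  have hM0 : 0 ≤ M := (norm_nonneg (fderiv ℝ (fderiv ℝ h) x)).trans (hM x)
  have key := (convex_closedBall x ‖v‖).norm_image_sub_le_of_norm_fderiv_le'
    (f := h) (φ := fderiv ℝ h x) (C := M * ‖v‖) (x := x) (y := x + v) (fun u _ => hd u)
    (fun u hu => (norm_fderiv_sub_le_of_norm_fderiv_fderiv_le hsm hM u x).trans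
      (mul_le_mul_of_nonneg_left (by simpa [dist_eq_norm] using hu) hM0))
    (by simp) (by simp)
  simpa [Real.norm_eq_abs, pow_two, mul_assoc] using key

end MeanValue

section Integrand

variable {E : Type*} [NormedAddCommGroup E] [NormedSpace ℝ E] {h : E → ℝ} {α M₁ M₂ : ℝ}

lemma integrable_compensated_increment (hα : 1 < α) (hα2 : α < 2) (hsm : ContDiff ℝ 2 h)
    (hM₁ : ∀ x, ‖fderiv ℝ h x‖ ≤ M₁) (hM₂ : ∀ x, ‖fderiv ℝ (fderiv ℝ h) x‖ ≤ M₂)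
    (x e : E) (he : ‖e‖ = 1) :
    Integrable (fun z : ℝ => (h (x + z • e) - h x
      - fderiv ℝ h x e * z * (if |z| ≤ 1 then 1 else 0)) * |z| ^ (-1 - α)) := by
  refine (integrable_piecewise_rpow_abs hα hα2 one_pos M₂ M₁).mono' ?_ (.of_forall fun z => ?_)
  · have hm : Measurable fun z : ℝ => h (x + z • e) :=
      (hsm.continuous.comp (by fun_prop : Continuous fun z : ℝ => x + z • e)).measurable
    have hi : Measurable fun z : ℝ => if |z| ≤ 1 then (1 : ℝ) else 0 :=
      Measurable.ite (measurableSet_le (by fun_prop) measurable_const) measurable_const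
        measurable_const
    exact (((hm.sub_const _).sub ((measurable_id.const_mul _).mul hi)).mul
      (by fun_prop)).aestronglyMeasurable
  · refine abs_mul_rpow_le_piecewise hα (fun hz => ?_) (fun hz => ?_)
    · simpa [hz, norm_smul, he, mul_comm] using abs_taylor_remainder_le hsm hM₂ x (z • e)
    · have hd : Differentiable ℝ h := hsm.differentiable (by norm_num)
      have := convex_univ.norm_image_sub_le_of_norm_fderiv_le (fun u _ => hd u)
        (fun u _ => hM₁ u) (mem_univ x) (mem_univ (x + z • e))
      simpa [not_le.2 hz, norm_smul, he] using this

lemma abs_integral_compensated_increment_sub_le (hα : 1 < α) (hα2 : α < 2)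
    (hsm : ContDiff ℝ 2 h)
    (hM₁ : ∀ x, ‖fderiv ℝ h x‖ ≤ M₁) (hM₂ : ∀ x, ‖fderiv ℝ (fderiv ℝ h) x‖ ≤ M₂)
    {x y : E} (hxy : x ≠ y) {e : E} (he : ‖e‖ = 1) :
    |(∫ z : ℝ, (h (x + z • e) - h x
        - fderiv ℝ h x e * z * (if |z| ≤ 1 then 1 else 0)) * |z| ^ (-1 - α))
      - ∫ z : ℝ, (h (y + z • e) - h y
        - fderiv ℝ h y e * z * (if |z| ≤ 1 then 1 else 0)) * |z| ^ (-1 - α)|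
      ≤ 2 * M₂ / ((2 - α) * (α - 1)) * ‖x - y‖ ^ (2 - α) := by
  set F : E → ℝ → ℝ := fun x z => (h (x + z • e) - h x
        - fderiv ℝ h x e * z * (if |z| ≤ 1 then 1 else 0)) * |z| ^ (-1 - α) with hF
  have hFi (x : E) : Integrable (F x) :=
    integrable_compensated_increment hα hα2 hsm hM₁ hM₂ x e he
  have hsymm (x : E) : ∫ z, F x z = (∫ z, (F x z + F x (-z))) / 2 := by
    rw [integral_add (hFi x) (hFi x).comp_neg, integral_neg_eq_self]
    ring
  have hsi (x : E) : Integrable fun z => F x z + F x (-z) := (hFi x).add (hFi x).comp_neg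
  have hr : 0 < ‖x - y‖ := norm_pos_iff.2 (sub_ne_zero.2 hxy)
  have hS (x : E) (z : ℝ) :
      |(h (x + z • e) - h x) - (h (x - z • e + z • e) - h (x - z • e))| ≤ M₂ * z ^ 2 := by
    refine (abs_second_difference_le hsm hM₂ x (x - z • e) (z • e)).trans_eq ?_
    simp only [sub_sub_cancel, norm_smul, he, mul_one, Real.norm_eq_abs]
    rw [mul_assoc, abs_mul_abs_self, pow_two]
  have hbound (z : ℝ) : ‖(F x z + F x (-z)) - (F y z + F y (-z))‖ ≤
      if |z| ≤ ‖x - y‖ then 2 * M₂ * |z| ^ (1 - α)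
      else 2 * M₂ * ‖x - y‖ * |z| ^ (-α) := by
    have hrep : (F x z + F x (-z)) - (F y z + F y (-z)) =
        ((h (x + z • e) - h x + (h (x - z • e) - h x))
          - (h (y + z • e) - h y + (h (y - z • e) - h y))) * |z| ^ (-1 - α) := by
      simp only [hF, abs_neg, neg_smul, ← sub_eq_add_neg]
      ring
    rw [hrep]
    refine abs_mul_rpow_le_piecewise hα (fun _ => ?_) (fun _ => ?_)
    · have h1 := abs_le.1 (hS x z)
      have h2 := abs_le.1 (hS y z)
      simp only [sub_add_cancel] at h1 h2
      rw [abs_le]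
      constructor <;> linarith [h1.1, h1.2, h2.1, h2.2]
    · have h1 := abs_le.1 (abs_second_difference_le hsm hM₂ x y (z • e))
      have h2 := abs_le.1 (abs_second_difference_le hsm hM₂ x y (-(z • e)))
      simp only [norm_neg, norm_smul, he, mul_one, Real.norm_eq_abs, ← sub_eq_add_neg] at h1 h2
      rw [abs_le]
      constructor <;> linarith [h1.1, h1.2, h2.1, h2.2]
  have hmain := norm_integral_le_of_norm_le
    (integrable_piecewise_rpow_abs hα hα2 hr (2 * M₂) (2 * M₂ * ‖x - y‖)) (.of_forall hbound)
  rw [integral_piecewise_rpow_abs hα hα2 hr, integral_sub (hsi x) (hsi y)] at hmain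
  rw [hsymm x, hsymm y, ← sub_div, abs_div, abs_two, div_le_iff₀ two_pos]
  refine hmain.trans_eq ?_
  have hpow : ‖x - y‖ ^ (2 - α) = ‖x - y‖ * ‖x - y‖ ^ (1 - α) := by
    nth_rw 2 [← Real.rpow_one ‖x - y‖]
    rw [← Real.rpow_add hr]
    congr 1; ring
  have h1 : 2 - α ≠ 0 := by linarith
  have h2 : α - 1 ≠ 0 := by linarith
  rw [hpow]
  field_simp
  ring

end Integrand

theorem fracLap_holder_continuity
    (d : ℕ) (hd : 1 ≤ d) (α : ℝ) (hα : 1 < α) (hα2 : α < 2) (pα : ℝ) (hpα : 0 < pα)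
    (h : EuclideanSpace ℝ (Fin d) → ℝ) (hsm : ContDiff ℝ 2 h) (M₁ M₂ : ℝ)
    (hM₁ : ∀ x, ‖gradient h x‖ ≤ M₁)
    (hM₂ : ∀ x, ‖fderiv ℝ (fderiv ℝ h) x‖ ≤ M₂) :
    ∀ x y : EuclideanSpace ℝ (Fin d),
      |fracLap d α pα h x - fracLap d α pα h y|
        ≤ 4 * d * pα * M₂ / ((2 - α) * (α - 1)) * ‖x - y‖ ^ (2 - α) := by
  intro x y
  have hfd (x) : ‖fderiv ℝ h x‖ ≤ M₁ := by simpa [gradient] using hM₁ x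
  have hM0 : 0 ≤ M₂ := (norm_nonneg (fderiv ℝ (fderiv ℝ h) x)).trans (hM₂ x)
  have hden : 0 < (2 - α) * (α - 1) := mul_pos (by linarith) (by linarith)
  rcases eq_or_ne x y with rfl | hxy
  · rw [sub_self, abs_zero]
    positivity
  have hterm := fun i : Fin d => abs_integral_compensated_increment_sub_le hα hα2 hsm hfd hM₂
    hxy (e := EuclideanSpace.single i (1 : ℝ)) (by simp)
  rw [fracLap, fracLap, ← Finset.sum_sub_distrib]
  simp only [← mul_sub]
  calc _ ≤ ∑ _i : Fin d, pα * (2 * M₂ / ((2 - α) * (α - 1)) * ‖x - y‖ ^ (2 - α)) := by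
        refine (Finset.abs_sum_le_sum_abs _ _).trans (Finset.sum_le_sum fun i _ => ?_)
        rw [abs_mul, abs_of_pos hpα]
        exact mul_le_mul_of_nonneg_left (hterm i) hpα.le
    _ = 2 * d * pα * M₂ / ((2 - α) * (α - 1)) * ‖x - y‖ ^ (2 - α) := by
        rw [Finset.sum_const, Finset.card_univ, Fintype.card_fin, nsmul_eq_mul]
        ring
    _ ≤ _ := by
        gcongr
        norm_num
end
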